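/- arXiv:1704.02823 — 2 statements merged into one kernel-verified Lean document; each statement's English description precedes it below -/
import Mathlib

section
/- Let (S, d) be a metric space with its Borel σ-algebra, let (𝓕_t)_{t≥0} be a filtration of sub-σ-algebras of the Borel σ-algebra, and fix times 0 ≤ s < t. Let (P_n) be a sequence of Borel probability measures on S converging weakly to a Borel probability measure P. Suppose M_s, M_t : S → ℝ are bounded continuous functions with |M_s| ≤ 1 and |M_t| ≤ 1, and for each n, M_s^n, M_t^n : S → ℝ are Borel measurable with |M_s^n| ≤ 1 and |M_t^n| ≤ 1 such that: (i) for every bounded continuous 𝓕_s-measurable f : S → ℝ and every n, ∫ M_t^n f dP_n = ∫ M_s^n f dP_n; and (ii) for every ε > 0 there exists N such that for all n ≥ N there is a Borel set E ⊆ S with P_n(E) > 1 − ε and sup_{x ∈ E} max(|M_t^n(x) − M_t(x)|, |M_s^n(x) − M_s(x)|) ≤ ε. Then for every bounded continuous 𝓕_s-measurable f : S → ℝ, ∫ M_t f dP = ∫ M_s f dP. (In other words, the uniform-on-large-probability-sets limit of discrete martingale observables retains the martingale property under the weak limit measure.) -/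
open MeasureTheory Filter

/-- A function bounded by `a` on `E` and by `b` everywhere has integral at most
`a + b * μ Eᶜ` in absolute value, for a probability measure `μ`. -/
theorem abs_integral_le_add_mul_measureReal_compl {S : Type*} [MeasurableSpace S]
    {μ : Measure S} [IsProbabilityMeasure μ] {h : S → ℝ} {E : Set S} {a b : ℝ}
    (hE : MeasurableSet E) (ha : 0 ≤ a)
    (hhE : ∀ x ∈ E, |h x| ≤ a) (hh : ∀ x, |h x| ≤ b) :
    |∫ x, h x ∂μ| ≤ a + b * μ.real Eᶜ := by
  have hint : Integrable (Eᶜ.indicator fun _ => b) μ :=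
    (integrable_const b).indicator hE.compl
  calc |∫ x, h x ∂μ| ≤ ∫ x, (a + Eᶜ.indicator (fun _ => b) x) ∂μ := by
        rw [← Real.norm_eq_abs]
        refine norm_integral_le_of_norm_le ((integrable_const a).add hint) (ae_of_all _ fun x => ?_)
        rw [Real.norm_eq_abs]
        by_cases hx : x ∈ E
        · simpa [hx] using hhE x hx
        · simpa [hx] using (hh x).trans (le_add_of_nonneg_left ha)
    _ = a + b * μ.real Eᶜ := by
        rw [integral_add (integrable_const a) hint, integral_indicator_const b hE.compl]
        simp [mul_comm]

/-- The uniform-on-large-probability-sets limit of discrete martingale observables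
retains the martingale property under the weak limit measure. -/
theorem martingale_property_passes_to_weak_limit
    {S : Type*} [MetricSpace S] [MeasurableSpace S] [BorelSpace S]
    (𝓕 : ℝ → MeasurableSpace S)
    (h𝓕mono : ∀ u v : ℝ, u ≤ v → 𝓕 u ≤ 𝓕 v)
    (h𝓕le : ∀ u : ℝ, 𝓕 u ≤ ‹MeasurableSpace S›)
    (s t : ℝ) (hs : 0 ≤ s) (hst : s < t)
    (Pn : ℕ → Measure S) (P : Measure S)
    (hPn : ∀ n, IsProbabilityMeasure (Pn n)) (hP : IsProbabilityMeasure P)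
    (hweak : ∀ g : S → ℝ, Continuous g → (∃ C, ∀ x, |g x| ≤ C) →
      Tendsto (fun n => ∫ x, g x ∂(Pn n)) atTop (nhds (∫ x, g x ∂P)))
    (Ms Mt : S → ℝ) (hMsc : Continuous Ms) (hMtc : Continuous Mt)
    (hMs1 : ∀ x, |Ms x| ≤ 1) (hMt1 : ∀ x, |Mt x| ≤ 1)
    (Msn Mtn : ℕ → S → ℝ)
    (hMsn : ∀ n, Measurable (Msn n)) (hMtn : ∀ n, Measurable (Mtn n))
    (hMsn1 : ∀ n x, |Msn n x| ≤ 1) (hMtn1 : ∀ n x, |Mtn n x| ≤ 1)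
    (hmart : ∀ f : S → ℝ, Continuous f → (∃ C, ∀ x, |f x| ≤ C) →
      Measurable[𝓕 s] f →
      ∀ n, ∫ x, Mtn n x * f x ∂(Pn n) = ∫ x, Msn n x * f x ∂(Pn n))
    (hunif : ∀ ε > (0 : ℝ), ∃ N : ℕ, ∀ n ≥ N, ∃ E : Set S, MeasurableSet E ∧
      ((Pn n) E).toReal > 1 - ε ∧
      ∀ x ∈ E, max |Mtn n x - Mt x| |Msn n x - Ms x| ≤ ε) :
    ∀ f : S → ℝ, Continuous f → (∃ C, ∀ x, |f x| ≤ C) →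
      Measurable[𝓕 s] f →
      ∫ x, Mt x * f x ∂P = ∫ x, Ms x * f x ∂P := by
  rintro f hf ⟨C₀, hC₀⟩ hfm
  obtain ⟨C, hC, hfC⟩ : ∃ C : ℝ, 0 ≤ C ∧ ∀ x, |f x| ≤ C :=
    ⟨|C₀|, abs_nonneg _, fun x => (hC₀ x).trans (le_abs_self _)⟩
  have hmul : ∀ (μ : Measure S) [IsProbabilityMeasure μ] (M : S → ℝ), Measurable M →
      (∀ x, |M x| ≤ 1) → Integrable (fun x => M x * f x) μ := by
    intro μ _ M hM hM1
    refine Integrable.of_bound (hM.mul hf.measurable).aestronglyMeasurable C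
      (ae_of_all _ fun x => ?_)
    rw [Real.norm_eq_abs, abs_mul]
    exact (mul_le_of_le_one_left (abs_nonneg _) (hM1 x)).trans (hfC x)
  have hbdd : ∃ K, ∀ x, |Mt x * f x - Ms x * f x| ≤ K := by
    refine ⟨2 * C, fun x => ?_⟩
    rw [← sub_mul, abs_mul]
    have := abs_sub (Mt x) (Ms x)
    gcongr
    · linarith [hMs1 x, hMt1 x]
    · exact hfC x
  have hlim := hweak (fun x => Mt x * f x - Ms x * f x) ((hMtc.mul hf).sub (hMsc.mul hf)) hbdd
  have hzero : Tendsto (fun n => ∫ x, (Mt x * f x - Ms x * f x) ∂(Pn n)) atTop (nhds 0) := by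
    rw [Metric.tendsto_atTop]
    intro δ hδ
    have hpos : 0 < 6 * C + 1 := by positivity
    obtain ⟨N, hN⟩ := hunif (δ / (6 * C + 1)) (by positivity)
    refine ⟨N, fun n hn => ?_⟩
    obtain ⟨E, hE, hPE, hME⟩ := hN n hn
    set ε := δ / (6 * C + 1)
    have hε0 : 0 < ε := by positivity
    have hεδ : ε * (6 * C + 1) = δ := div_mul_cancel₀ _ hpos.ne'
    have := hPn n
    have hrepr : ∫ x, (Mt x * f x - Ms x * f x) ∂(Pn n) =
        ∫ x, ((Mt x - Mtn n x) - (Ms x - Msn n x)) * f x ∂(Pn n) := by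
      have h₁ := hmul (Pn n) _ hMtc.measurable hMt1
      have h₂ := hmul (Pn n) _ hMsc.measurable hMs1
      have h₃ := hmul (Pn n) _ (hMtn n) (hMtn1 n)
      have h₄ := hmul (Pn n) _ (hMsn n) (hMsn1 n)
      have heq := hmart f hf ⟨C, hfC⟩ hfm n
      simp only [sub_mul]
      rw [integral_sub (f := fun x => Mt x * f x - Mtn n x * f x)
        (g := fun x => Ms x * f x - Msn n x * f x) (h₁.sub h₃) (h₂.sub h₄), integral_sub h₁ h₂, integral_sub h₁ h₃,
        integral_sub h₂ h₄]
      linarith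
    have hcompl : (Pn n).real Eᶜ ≤ ε := by
      rw [probReal_compl_eq_one_sub hE]
      change 1 - ((Pn n) E).toReal ≤ ε
      linarith
    have hle := abs_integral_le_add_mul_measureReal_compl (μ := Pn n)
      (h := fun x => ((Mt x - Mtn n x) - (Ms x - Msn n x)) * f x)
      (a := 2 * ε * C) (b := 4 * C) hE (by positivity)
      (fun x hx => by
        have h₁ := (le_max_left _ _).trans (hME x hx)
        have h₂ := (le_max_right _ _).trans (hME x hx)
        rw [abs_sub_comm] at h₁ h₂
        rw [abs_mul]
        have := abs_sub (Mt x - Mtn n x) (Ms x - Msn n x)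
        gcongr
        · linarith
        · exact hfC x)
      (fun x => by
        rw [abs_mul]
        have h₁ := abs_sub (Mt x - Mtn n x) (Ms x - Msn n x)
        have h₂ := abs_sub (Mt x) (Mtn n x)
        have h₃ := abs_sub (Ms x) (Msn n x)
        gcongr
        · linarith [hMt1 x, hMs1 x, hMtn1 n x, hMsn1 n x]
        · exact hfC x)
    rw [Real.dist_eq, sub_zero, hrepr]
    have : 4 * C * (Pn n).real Eᶜ ≤ 4 * C * ε := by gcongr
    linarith
  have h := tendsto_nhds_unique hlim hzero
  rw [integral_sub (hmul P _ hMtc.measurable hMt1) (hmul P _ hMsc.measurable hMs1)] at h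
  exact sub_eq_zero.mp h
end

section
/- For every real z with 0 ≤ z < 1, the series ∑_{n=0}^∞ [ (3/4)_n (1/4)_n / ( (3/2)_n · n! ) ] zⁿ converges and its sum equals √2 · (1 + √(1 − z))^{−1/2}, where (a)_n = a(a+1)⋯(a+n−1) denotes the ascending Pochhammer symbol (with (a)_0 = 1). In other words, the Gauss hypergeometric function ₂F₁(3/4, 1/4; 3/2; z), defined by this power series, has the closed form √2 (1 + √(1 − z))^{−1/2} on [0, 1). -/
theorem Ring.choose_succ_eq_mul_div {K : Type*} [Field K] [CharZero K] (a : K) (n : ℕ) :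
    Ring.choose a (n + 1) = Ring.choose a n * (a - n) / (n + 1) := by
  have h : (n.factorial : K) ≠ 0 := Nat.cast_ne_zero.mpr n.factorial_ne_zero
  have h' : (n : K) + 1 ≠ 0 := Nat.cast_add_one_ne_zero n
  simp only [Ring.choose_eq_smul, descPochhammer_succ_right, Polynomial.smeval_mul,
    Polynomial.smeval_sub, Polynomial.smeval_X, Polynomial.smeval_natCast, Nat.factorial_succ,
    smul_eq_mul, pow_one, pow_zero, nsmul_eq_mul, mul_one, Nat.cast_mul, Nat.cast_succ]
  field_simp

theorem Real.hasSum_choose_mul_pow (a : ℝ) {x : ℝ} (hx : |x| < 1) :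
    HasSum (fun n : ℕ => Ring.choose a n * x ^ n) ((1 + x) ^ a) := by
  have hmem : x ∈ Metric.eball (0 : ℝ) 1 := by
    rw [← ENNReal.ofReal_one, Metric.eball_ofReal]
    simpa using hx
  simpa [-FormalMultilinearSeries.apply_eq_prod_smul_coeff] using
    (Real.one_add_rpow_hasFPowerSeriesOnBall_zero (a := a)).hasSum hmem

/-- The odd part of a power series, read off from its sums at `x` and `-x`. -/
theorem HasSum.two_mul_odd_of_neg {c : ℕ → ℝ} {x s t : ℝ}
    (hs : HasSum (fun n => c n * x ^ n) s) (ht : HasSum (fun n => c n * (-x) ^ n) t) :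
    HasSum (fun n => 2 * c (2 * n + 1) * x ^ (2 * n + 1)) (s - t) := by
  have hinj : Function.Injective fun n : ℕ => 2 * n + 1 := fun m n h => by
    simpa using h
  refine ((hinj.hasSum_iff fun n hn => ?_).mpr (hs.sub ht)).congr_fun fun n => ?_
  · have heven : Even n := by
      by_contra h
      obtain ⟨k, rfl⟩ := Nat.not_even_iff_odd.mp h
      exact hn ⟨k, rfl⟩
    rw [heven.neg_pow, sub_self]
  · have hodd : Odd (2 * n + 1) := ⟨n, rfl⟩
    simp only [Function.comp_apply, hodd.neg_pow]
    ring

theorem two_mul_choose_half_odd (n : ℕ) :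
    2 * Ring.choose (1 / 2 : ℝ) (2 * n + 1) =
      ((ascPochhammer ℝ n).eval (3 / 4) * (ascPochhammer ℝ n).eval (1 / 4)) /
        ((ascPochhammer ℝ n).eval (3 / 2) * (n.factorial : ℝ)) := by
  induction n with
  | zero => simp
  | succ n ih =>
    have hpoch : (ascPochhammer ℝ n).eval (3 / 2) ≠ 0 := (ascPochhammer_pos n _ (by norm_num)).ne'
    have hfact : (n.factorial : ℝ) ≠ 0 := Nat.cast_ne_zero.mpr n.factorial_ne_zero
    have hstep : 2 * Ring.choose (1 / 2 : ℝ) (2 * (n + 1) + 1) =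
        2 * Ring.choose (1 / 2 : ℝ) (2 * n + 1) *
          ((3 / 4 + n) * (1 / 4 + n) / ((3 / 2 + n) * (n + 1))) := by
      rw [show 2 * (n + 1) + 1 = 2 * n + 1 + 1 + 1 by ring, Ring.choose_succ_eq_mul_div,
        Ring.choose_succ_eq_mul_div]
      push_cast
      field_simp
      ring
    rw [hstep, ih]
    simp only [ascPochhammer_succ_eval, Nat.factorial_succ, Nat.cast_mul, Nat.cast_succ]
    field_simp

theorem sqrt_one_add_sub_sqrt_one_sub_eq {w : ℝ} (hw0 : 0 ≤ w) (hw1 : w < 1) :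
    √(1 + w) - √(1 - w) = w * (√2 * (1 + √(1 - w ^ 2)) ^ (-(1 / 2 : ℝ))) := by
  have hp : 0 < √(1 + w) := Real.sqrt_pos.mpr (by linarith)
  have hq : 0 < √(1 - w) := Real.sqrt_pos.mpr (by linarith)
  have hp2 : √(1 + w) ^ 2 = 1 + w := Real.sq_sqrt (by linarith)
  have hq2 : √(1 - w) ^ 2 = 1 - w := Real.sq_sqrt (by linarith)
  have hpq : √(1 - w ^ 2) = √(1 + w) * √(1 - w) := by
    rw [← Real.sqrt_mul (by linarith)]
    ring_nf
  have hsqrt : √(1 + √(1 - w ^ 2)) = (√(1 + w) + √(1 - w)) / √2 := by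
    rw [Real.sqrt_eq_iff_mul_self_eq (by positivity) (by positivity), hpq, div_mul_div_comm,
      Real.mul_self_sqrt (by norm_num)]
    linarith
  rw [Real.rpow_neg (by positivity), ← Real.sqrt_eq_rpow, hsqrt, inv_div, ← mul_div_assoc,
    Real.mul_self_sqrt (by norm_num)]
  field_simp
  linarith


/-- The Gauss hypergeometric function `₂F₁(3/4, 1/4; 3/2; z)`, defined by its power series
with ascending Pochhammer coefficients, has the closed form `√2 (1 + √(1 − z))^{−1/2}`
for `0 ≤ z < 1`. -/
theorem hypergeometric_closed_form
    (z : ℝ) (hz0 : 0 ≤ z) (hz1 : z < 1) :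
    HasSum
      (fun n : ℕ =>
        ((ascPochhammer ℝ n).eval (3 / 4) * (ascPochhammer ℝ n).eval (1 / 4)) /
          ((ascPochhammer ℝ n).eval (3 / 2) * (n.factorial : ℝ)) * z ^ n)
      (Real.sqrt 2 * (1 + Real.sqrt (1 - z)) ^ (-(1 / 2 : ℝ))) := by
  rcases hz0.eq_or_lt with rfl | hzpos
  · have hval : √2 * (1 + √(1 - 0)) ^ (-(1 / 2 : ℝ)) = 1 := by
      rw [sub_zero, Real.sqrt_one, one_add_one_eq_two, Real.rpow_neg zero_le_two,
        ← Real.sqrt_eq_rpow, mul_inv_cancel₀ (by positivity)]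
    rw [hval]
    convert hasSum_single (f := fun n : ℕ =>
        ((ascPochhammer ℝ n).eval (3 / 4) * (ascPochhammer ℝ n).eval (1 / 4)) /
          ((ascPochhammer ℝ n).eval (3 / 2) * (n.factorial : ℝ)) * (0 : ℝ) ^ n) 0
      fun n hn => by simp [hn] using 1
    simp
  · obtain ⟨w, hw, rfl⟩ : ∃ w : ℝ, 0 < w ∧ w ^ 2 = z :=
      ⟨√z, Real.sqrt_pos.mpr hzpos, Real.sq_sqrt hz0⟩
    have hw1 : w < 1 := by nlinarith
    have habs : |w| < 1 := by rwa [abs_of_pos hw]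
    have hsum := (Real.hasSum_choose_mul_pow (1 / 2) habs).two_mul_odd_of_neg
      (Real.hasSum_choose_mul_pow (1 / 2) (by rwa [abs_neg]))
    rw [← Real.sqrt_eq_rpow, ← Real.sqrt_eq_rpow, ← sub_eq_add_neg,
      sqrt_one_add_sub_sqrt_one_sub_eq hw.le hw1] at hsum
    refine (hasSum_mul_left_iff hw.ne').mp (hsum.congr_fun fun n => ?_)
    rw [two_mul_choose_half_odd]
    ring
end
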